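/- Let R be a commutative k-algebra with a Leibnitz kLT(𝔇)-module algebra structure, where 𝔇 = Der(R). Then the R-linear span ℐ of the elements 1#T − Σ_{(T_i)} (T_{i(1)}·r) # T(i, E, T_{i(2)}), taken over all labeled trees T, all non-root nodes i of T, and all factorizations rE (r ∈ R, E ∈ 𝔇) of the label of node i, is a two-sided ideal in the smash product R#kLT(𝔇). -/

import Mathlib

/-- An ordered labeled subtree: a node with a label and an ordered list of children. -/
inductive LSub (D : Type) : Type
  | mk : D → List (LSub D) → LSub D

/-- An ordered rooted tree with unlabeled root and non-root nodes labeled in `D`,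
represented by the list of subtrees attached to the root. -/
abbrev LTree (D : Type) := List (LSub D)

mutual
  /-- Number of nodes of a labeled subtree. -/
  def sizeS {D : Type} : LSub D → Nat
    | .mk _ ts => 1 + sizeL ts
  /-- Total number of (labeled) nodes of a forest. -/
  def sizeL {D : Type} : List (LSub D) → Nat
    | [] => 0
    | t :: ts => sizeS t + sizeL ts
end

mutual
  /-- Graft pending subtrees (given by `f`, indexed by the preorder index of nodes)
  onto a subtree whose own preorder index is `i`; attached subtrees are prepended. -/
  def graftS {D : Type} (f : Nat → List (LSub D)) (i : Nat) : LSub D → LSub D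
    | .mk d ts => .mk d (f i ++ graftL f (i + 1) ts)
  def graftL {D : Type} (f : Nat → List (LSub D)) (i : Nat) : List (LSub D) → List (LSub D)
    | [] => []
    | t :: ts => graftS f i t :: graftL f (i + sizeS t) ts
end

/-- Graft pending subtrees onto a tree; the root has preorder index `0`. -/
def graft {D : Type} (f : Nat → List (LSub D)) (t : LTree D) : LTree D :=
  f 0 ++ graftL f 1 t

/-- All lists of length `m` with entries `< n` (choices of attachment nodes). -/
def choices : Nat → Nat → List (List Nat)
  | 0, _ => [[]]
  | m + 1, n => (List.range n).flatMap fun c => (choices m n).map (c :: ·)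

/-- The Grossman–Larson product of two basis trees, as an element of the free module:
the sum over all ways of attaching the root-subtrees of `T1` to nodes of `T2`. -/
noncomputable def mulT (k : Type) [Semiring k] {D : Type} (T1 T2 : LTree D) :
    LTree D →₀ k :=
  ((choices T1.length (1 + sizeL T2)).map fun c =>
    Finsupp.single
      (graft (fun i => (T1.zip c).filterMap fun p => if p.2 = i then some p.1 else none) T2)
      (1 : k)).sum

/-- `v E`: the two-node tree whose single non-root node is labeled `E`. -/
def vT {D : Type} (E : D) : LTree D := [.mk E []]

/-- `u(E; T₁,…,T_k)`: root has one child labeled `E`, with which the roots of the `Tᵢ`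
are identified. -/
def uT {D : Type} (E : D) (Ts : List (LTree D)) : LTree D := [.mk E Ts.flatten]

/-- `t(T₁,…,T_k)`: identify the roots of the `Tᵢ`. -/
def tT {D : Type} (Ts : List (LTree D)) : LTree D := Ts.flatten

/-- All decompositions of an ordered multiset into a sub-multiset and its complement
(used for the coproduct). -/
def splits {α : Type} : List α → List (List α × List α)
  | [] => [([], [])]
  | a :: l => ((splits l).map fun p => (a :: p.1, p.2)) ++ ((splits l).map fun p => (p.1, a :: p.2))

/-- The labeled node of `T` at position `(i, p)`: the `i`-th root-subtree, then follow
the path `p` of child indices. -/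
def subAtL {D : Type} : List (LSub D) → Nat → List Nat → Option (LSub D)
  | [], _, _ => none
  | t :: _, 0, [] => some t
  | .mk _ cs :: _, 0, j :: p => subAtL cs j p
  | _ :: ts, i + 1, p => subAtL ts i p

/-- Replace the node of `T` at position `(i, p)`: relabel it with `G` and replace the
subtree rooted there (its list of children) by `T'`. -/
def replaceAtL {D : Type} (G : D) (T' : List (LSub D)) :
    List (LSub D) → Nat → List Nat → List (LSub D)
  | [], _, _ => []
  | _ :: ts, 0, [] => .mk G T' :: ts
  | .mk d cs :: ts, 0, j :: p => .mk d (replaceAtL G T' cs j p) :: ts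
  | t :: ts, i + 1, p => t :: replaceAtL G T' ts i p

/-- A `kLT(𝔇)`-module algebra structure on `R` (𝔇 = Der(R)), described via the action
`act` of basis trees: the one-node tree acts as the identity, each tree acts `k`-linearly,
the action is compatible with the tree-attachment product, and satisfies the module
algebra (Hopf) condition with respect to the splitting coproduct. -/
def IsTreeAction (k R : Type) [CommRing k] [CommRing R] [Algebra k R]
    (act : LTree (Derivation k R R) → R → R) : Prop :=
  (∀ f : R, act [] f = f) ∧
  (∀ (T : LTree (Derivation k R R)) (a : k) (f g : R),
    act T (a • f + g) = a • act T f + act T g) ∧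
  (∀ (T₁ T₂ : LTree (Derivation k R R)) (f : R),
    ((mulT k T₁ T₂).sum fun T c => c • act T f) = act T₁ (act T₂ f)) ∧
  (∀ (T : LTree (Derivation k R R)) (f g : R),
    act T (f * g) = ((splits T).map fun q => act q.1 f * act q.2 g).sum)

/-- The `kLT(𝔇)`-module algebra structure `act` is *Leibnitz* if for every tree `T`,
every non-root node (at position `(i, p)`) whose label factors as `r • E`, and every
`s ∈ R`, `T·s = Σ_{(T_i)} (T_{i(1)}·r) (T(i, E, T_{i(2)})·s)`, the coproduct being taken
in the subtree `T_i` rooted at the node. -/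
def IsLeibnitz (k R : Type) [CommRing k] [CommRing R] [Algebra k R]
    (act : LTree (Derivation k R R) → R → R) : Prop :=
  ∀ (T : LTree (Derivation k R R)) (i : Nat) (p : List Nat)
    (D₀ : Derivation k R R) (Ti : List (LSub (Derivation k R R))),
    subAtL T i p = some (LSub.mk D₀ Ti) →
    ∀ (r : R) (E : Derivation k R R), D₀ = r • E →
    ∀ s : R,
      act T s =
        ((splits Ti).map fun q => act q.1 r * act (replaceAtL E q.2 T i p) s).sum

/-- The action `act` is *coherent* if any subtree whose root has a single child and which
acts on `R` as a derivation `E` may be replaced by the two-node tree `v(E)` without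
changing the action of the ambient tree. -/
def IsCoherent (k R : Type) [CommRing k] [CommRing R] [Algebra k R]
    (act : LTree (Derivation k R R) → R → R) : Prop :=
  ∀ (T : LTree (Derivation k R R)) (i : Nat) (p : List Nat)
    (d : Derivation k R R) (cs : List (LSub (Derivation k R R))) (E : Derivation k R R),
    subAtL T i p = some (LSub.mk d cs) →
    (∀ f : R, act [LSub.mk d cs] f = E f) →
    ∀ f : R, act T f = act (replaceAtL E [] T i p) f

/-- A connection on `Der(R)`. -/
def IsConnection (k R : Type) [CommRing k] [CommRing R] [Algebra k R]
    (c : Derivation k R R → Derivation k R R → Derivation k R R) : Prop :=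
  (∀ E₁ E₂ F, c (E₁ + E₂) F = c E₁ F + c E₂ F) ∧
  (∀ E F₁ F₂, c E (F₁ + F₂) = c E F₁ + c E F₂) ∧
  (∀ (f : R) (E F), c (f • E) F = f • c E F) ∧
  (∀ (f : R) (E F), c E (f • F) = f • c E F + (E f) • F)

/-- The smash product `R # kLT(𝔇)` realized as the free `R`-module on labeled trees,
with smash multiplication
`(r#T₁)(s#T₂) = Σ_{(T₁)} r·(T₁⁽¹⁾·s) # (T₁⁽²⁾·T₂)`. -/
noncomputable def smashMulS (k R : Type) [CommRing k] [CommRing R] [Algebra k R]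
    (act : LTree (Derivation k R R) → R → R)
    (x y : LTree (Derivation k R R) →₀ R) : LTree (Derivation k R R) →₀ R :=
  x.sum fun T₁ r => y.sum fun T₂ s =>
    ((splits T₁).map fun q => (r * act q.1 s) • (mulT R q.2 T₂)).sum

/-- The generators of the Leibnitz ideal: the elements
`1#T − Σ_{(T_i)} (T_{i(1)}·r) # T(i, E, T_{i(2)})` over all trees `T`, all non-root nodes
`(i, p)` of `T`, and all factorizations `r•E` of the label of that node. -/
noncomputable def leibnizGens (k R : Type) [CommRing k] [CommRing R] [Algebra k R]
    (act : LTree (Derivation k R R) → R → R) :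
    Set (LTree (Derivation k R R) →₀ R) :=
  { z | ∃ (T : LTree (Derivation k R R)) (i : Nat) (p : List Nat)
      (D₀ : Derivation k R R) (Ti : List (LSub (Derivation k R R)))
      (r : R) (E : Derivation k R R),
      subAtL T i p = some (LSub.mk D₀ Ti) ∧ D₀ = r • E ∧
      z = Finsupp.single T 1 -
        ((splits Ti).map fun q =>
          Finsupp.single (replaceAtL E q.2 T i p) (act q.1 r)).sum }

namespace LeibAux

section sums
variable {α β M : Type} [AddCommMonoid M]

/-- Sum of `F` over a multiset. -/
def msum (m : Multiset α) (F : α → M) : M := (m.map F).sum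

theorem msum_zero (F : α → M) : msum 0 F = 0 := by simp [msum]
theorem msum_singleton (a : α) (F : α → M) : msum {a} F = F a := by simp [msum]
theorem msum_const_zero (m : Multiset α) : msum m (fun _ => (0 : M)) = 0 := by simp [msum]
theorem msum_add (m : Multiset α) (F G : α → M) :
    msum m (fun a => F a + G a) = msum m F + msum m G := by
  simp [msum]
theorem msum_add_left (m n : Multiset α) (F : α → M) :
    msum (m + n) F = msum m F + msum n F := by
  simp [msum]
theorem msum_map (m : Multiset β) (g : β → α) (F : α → M) :
    msum (m.map g) F = msum m (fun b => F (g b)) := by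
  simp [msum]
theorem msum_bind (m : Multiset β) (g : β → Multiset α) (F : α → M) :
    msum (m.bind g) F = msum m (fun b => msum (g b) F) := by
  simp [msum, Multiset.map_bind, Multiset.sum_bind]
theorem msum_comm (m : Multiset α) (n : Multiset β) (F : α → β → M) :
    msum m (fun a => msum n (F a)) = msum n (fun b => msum m (fun a => F a b)) := by
  simp only [msum]
  exact Multiset.sum_map_sum_map m n
theorem msum_congr {m : Multiset α} {F G : α → M} (h : ∀ a ∈ m, F a = G a) :
    msum m F = msum m G := by
  simp only [msum]; rw [Multiset.map_congr rfl h]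
theorem msum_hom {N : Type} [AddCommMonoid N] (φ : M →+ N) (m : Multiset α) (F : α → M) :
    φ (msum m F) = msum m (fun a => φ (F a)) := by
  simp [msum, map_multiset_sum]

/-- Sum over splittings. -/
def sps (W : List α) (H : List α → List α → M) : M :=
  msum (↑(splits W) : Multiset (List α × List α)) (fun q => H q.1 q.2)

theorem sps_eq (W : List α) (H : List α → List α → M) :
    ((splits W).map fun q => H q.1 q.2).sum = sps W H := by
  simp [sps, msum]
theorem sps_nil (H : List α → List α → M) : sps [] H = H [] [] := by
  simp [sps, msum, splits]
theorem sps_cons (a : α) (W : List α) (H : List α → List α → M) :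
    sps (a :: W) H = sps W (fun A B => H (a :: A) B) + sps W (fun A B => H A (a :: B)) := by
  simp [sps, msum, splits, Function.comp_def]
theorem sps_add (W : List α) (H K : List α → List α → M) :
    sps W (fun A B => H A B + K A B) = sps W H + sps W K := msum_add _ _ _
theorem sps_zero (W : List α) : sps W (fun _ _ => (0 : M)) = 0 := msum_const_zero _
theorem sps_msum (W : List α) (m : Multiset β) (H : List α → List α → β → M) :
    sps W (fun A B => msum m (H A B)) = msum m (fun b => sps W (fun A B => H A B b)) :=
  msum_comm _ _ _
theorem sps_sps (W : List α) (V : List β) (H : List α → List α → List β → List β → M) :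
    sps W (fun A B => sps V (H A B)) = sps V (fun C D => sps W (fun A B => H A B C D)) :=
  msum_comm _ _ _

theorem sps_coassoc (W : List α) (H : List α → List α → List α → M) :
    sps W (fun A B => sps A (fun C D => H C D B)) =
      sps W (fun A B => sps B (fun C D => H A C D)) := by
  induction W generalizing H with
  | nil => simp [sps_nil]
  | cons a W ih => simp only [sps_cons, sps_add, ih, add_assoc]

theorem sps_comm (W : List α) (H : List α → List α → M) :
    sps W H = sps W (fun A B => H B A) := by
  induction W generalizing H with
  | nil => simp [sps_nil]
  | cons a W ih =>
    simp only [sps_cons]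
    rw [add_comm, ih (fun A B => H (a :: A) B), ih (fun A B => H A (a :: B))]

theorem sps_leftcomm (W : List α) (H : List α → List α → List α → M) :
    sps W (fun A B => sps B (fun C D => H A C D)) =
      sps W (fun A B => sps B (fun C D => H C A D)) := by
  rw [← sps_coassoc, ← sps_coassoc W (fun A C D => H C A D)]
  congr 1; funext A B; exact sps_comm _ _

theorem sps_append (V W : List α) (H : List α → List α → M) :
    sps (V ++ W) H = sps V (fun A B => sps W (fun C D => H (A ++ C) (B ++ D))) := by
  induction V generalizing H with
  | nil => simp [sps_nil]
  | cons a V ih => simp only [List.cons_append, sps_cons, ih]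

theorem sps_nil_right (W : List α) (H : List α → M) [∀ B : List α, Decidable (B = [])] :
    sps W (fun A B => if B = [] then H A else 0) = H W := by
  induction W generalizing H with
  | nil => simp [sps_nil]
  | cons a W ih => simp [sps_cons, ih (fun A => H (a :: A)), sps_zero]

theorem sps_nil_left (W : List α) (H : List α → M) [∀ B : List α, Decidable (B = [])] :
    sps W (fun A B => if A = [] then H B else 0) = H W := by
  rw [sps_comm]; exact sps_nil_right W H

theorem sps_hom {N : Type} [AddCommMonoid N] (φ : M →+ N) (W : List α)
    (H : List α → List α → M) : φ (sps W H) = sps W (fun A B => φ (H A B)) :=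
  msum_hom _ _ _

end sums

section assign
variable {α M : Type} [AddCommMonoid M]

def push (w : α) (j : ℕ) (f : ℕ → List α) : ℕ → List α :=
  fun i => if j = i then w :: f i else f i

def pw (c : ℕ) (f g : ℕ → List α) : ℕ → List α := fun i => if i < c then f i else g i

/-- All assignments of the entries of a list to the slots `a, …, a+n-1`. -/
def Phi : List α → ℕ → ℕ → Multiset (ℕ → List α)
  | [], _, _ => {fun _ => []}
  | w :: W, a, n => (Multiset.range n).bind fun j => (Phi W a n).map (push w (a + j))

theorem choices_eq (W : List α) (n : ℕ) (F : (ℕ → List α) → M) :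
    ((choices W.length n).map fun c =>
      F (fun i => (W.zip c).filterMap fun p => if p.2 = i then some p.1 else none)).sum
    = msum (Phi W 0 n) F := by
  induction W generalizing F with
  | nil => simp [choices, Phi, msum]
  | cons w W ih =>
    simp only [Phi, msum_bind, msum_map]
    simp only [List.length_cons, choices, List.map_flatMap, List.map_map, Function.comp_def,
      List.zip_cons_cons, zero_add]
    simp only [← ih]
    rw [msum, ← Multiset.coe_range, Multiset.map_coe, Multiset.sum_coe, List.flatMap,
      List.sum_flatten, List.map_map]
    congr 1
    refine List.map_congr_left fun j _ => ?_
    simp only [Function.comp_def]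
    congr 1
    refine List.map_congr_left fun c _ => ?_
    congr 1
    funext i
    by_cases h : j = i <;> simp [push, h]

theorem Phi_add (W : List α) (a n₁ n₂ : ℕ) (F : (ℕ → List α) → M) :
    msum (Phi W a (n₁ + n₂)) F =
      sps W (fun A B => msum (Phi A a n₁) (fun f => msum (Phi B (a + n₁) n₂) (fun g =>
        F (pw (a + n₁) f g)))) := by
  induction W generalizing F with
  | nil =>
    simp only [Phi, sps_nil, msum_singleton]
    congr 1; funext i; simp [pw]
  | cons w W ih =>
    simp only [Phi, sps_cons, msum_bind, msum_map, Multiset.range_add, msum_add_left]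
    congr 1
    · rw [sps_msum]
      refine msum_congr fun j hj => ?_
      rw [ih]
      have hj' := Multiset.mem_range.1 hj
      congr 1; funext A B
      refine msum_congr fun f _ => msum_congr fun g _ => ?_
      congr 1; funext i
      simp only [pw, push]; split_ifs <;> first | rfl | omega
    · simp_rw [msum_comm (Phi _ a n₁) (Multiset.range n₂)]
      rw [sps_msum]
      refine msum_congr fun j hj => ?_
      rw [ih]
      congr 1; funext A B
      refine msum_congr fun f _ => msum_congr fun g _ => ?_
      congr 1; funext i
      simp only [pw, push]; split_ifs <;> first | rfl | omega

theorem Phi_zero [∀ W : List α, Decidable (W = [])] (W : List α) (a : ℕ) :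
    Phi W a 0 = if W = [] then {fun _ => []} else 0 := by
  cases W <;> simp [Phi]

theorem Phi_one (W : List α) (a : ℕ) (F : (ℕ → List α) → M) :
    msum (Phi W a 1) F = F (fun i => if a = i then W else []) := by
  induction W generalizing F with
  | nil => simp [Phi, msum_singleton]
  | cons w W ih =>
    have : Multiset.range 1 = {0} := rfl
    simp only [Phi, msum_bind, msum_map, this, msum_singleton]
    rw [ih]
    congr 1; funext i
    simp only [push, add_zero]; split_ifs <;> rfl

end assign

section graft
variable {D M : Type} [AddCommMonoid M]

/-- Prepending the second list. -/
def GR (G : List (LSub D) → Multiset (List (LSub D))) (W : List (LSub D)) :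
    Multiset (List (LSub D)) :=
  (↑(splits W) : Multiset (List (LSub D) × List (LSub D))).bind fun q =>
    (G q.2).map fun T => q.1 ++ T

mutual
  noncomputable def GrS (t : LSub D) (W : List (LSub D)) : Multiset (LSub D) :=
    match t with
    | .mk d ts => (↑(splits W) : Multiset (List (LSub D) × List (LSub D))).bind fun q =>
        (GrL ts q.2).map fun T => .mk d (q.1 ++ T)
  noncomputable def GrL (ts : List (LSub D)) (W : List (LSub D)) : Multiset (List (LSub D)) :=
    match ts with
    | [] => open Classical in if W = [] then {[]} else 0
    | t :: ts => (↑(splits W) : Multiset (List (LSub D) × List (LSub D))).bind fun q =>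
        (GrS t q.1).bind fun t' => (GrL ts q.2).map fun T => t' :: T
end

noncomputable def GG (T W : List (LSub D)) : Multiset (List (LSub D)) := GR (GrL T) W

theorem msum_GG (T W : List (LSub D)) (F : List (LSub D) → M) :
    msum (GG T W) F = sps W (fun A B => msum (GrL T B) (fun T' => F (A ++ T'))) := by
  simp only [GG, GR, msum_bind, msum_map, sps]

theorem msum_GrS (d : D) (ts W : List (LSub D)) (F : LSub D → M) :
    msum (GrS (.mk d ts) W) F = msum (GG ts W) (fun T => F (.mk d T)) := by
  rw [msum_GG]
  simp only [GrS, msum_bind, msum_map, sps]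

theorem msum_GrL_nil (W : List (LSub D)) (F : List (LSub D) → M)
    [∀ W : List (LSub D), Decidable (W = [])] :
    msum (GrL [] W) F = if W = [] then F [] else 0 := by
  simp only [GrL]; split_ifs <;> simp [msum]

theorem msum_GrL_cons (t : LSub D) (ts W : List (LSub D)) (F : List (LSub D) → M) :
    msum (GrL (t :: ts) W) F = sps W (fun A B => msum (GrS t A) (fun t' =>
      msum (GrL ts B) (fun T => F (t' :: T)))) := by
  simp only [GrL, msum_bind, msum_map, sps]

mutual
  theorem graftS_congr (f g : ℕ → List (LSub D)) (t : LSub D) (i : ℕ)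
      (h : ∀ j, i ≤ j → j < i + sizeS t → f j = g j) : graftS f i t = graftS g i t := by
    match t with
    | .mk d ts =>
      simp only [sizeS] at h
      simp only [graftS]
      rw [h i le_rfl (by omega), graftL_congr f g ts (i + 1) (fun j h1 h2 => h j (by omega) (by omega))]
  theorem graftL_congr (f g : ℕ → List (LSub D)) (ts : List (LSub D)) (i : ℕ)
      (h : ∀ j, i ≤ j → j < i + sizeL ts → f j = g j) : graftL f i ts = graftL g i ts := by
    match ts with
    | [] => simp only [graftL]
    | t :: ts =>
      simp only [sizeL] at h
      simp only [graftL]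
      rw [graftS_congr f g t i (fun j h1 h2 => h j (by omega) (by omega)),
        graftL_congr f g ts _ (fun j h1 h2 => h j (by omega) (by omega))]
end

mutual
  theorem Phi_graftS (t : LSub D) (W : List (LSub D)) (i : ℕ) (F : LSub D → M) :
      msum (Phi W i (sizeS t)) (fun f => F (graftS f i t)) = msum (GrS t W) F := by
    match t with
    | .mk d ts =>
      simp only [sizeS]
      rw [Phi_add, msum_GrS, msum_GG]
      congr 1; funext A B
      rw [Phi_one, ← Phi_graftL ts B (i + 1)]
      refine msum_congr fun g _ => ?_
      simp only [graftS]
      rw [graftL_congr (pw (i + 1) _ g) g ts (i + 1) (fun j h1 _ => by simp [pw]; omega)]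
      simp [pw]
  theorem Phi_graftL (ts W : List (LSub D)) (i : ℕ) (F : List (LSub D) → M) :
      msum (Phi W i (sizeL ts)) (fun f => F (graftL f i ts)) = msum (GrL ts W) F := by
    classical
    match ts with
    | [] =>
      simp only [sizeL]
      rw [msum_GrL_nil, Phi_zero]
      simp only [graftL]
      split_ifs <;> simp [msum]
    | t :: ts =>
      simp only [sizeL]
      rw [Phi_add, msum_GrL_cons]
      congr 1; funext A B
      rw [← Phi_graftS t A i]
      refine msum_congr fun f _ => ?_
      rw [← Phi_graftL ts B (i + sizeS t)]
      refine msum_congr fun g _ => ?_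
      simp only [graftL]
      rw [graftL_congr (pw (i + sizeS t) f g) g ts _ (fun j h1 _ => by simp [pw]; omega),
        graftS_congr (pw (i + sizeS t) f g) f t i (fun j _ h2 => by simp [pw]; omega)]
end

theorem mulT_eq (k : Type) [Semiring k] (W T : LTree D) :
    mulT k W T = msum (GG T W) (fun T' => Finsupp.single T' (1 : k)) := by
  rw [mulT, choices_eq W (1 + sizeL T) (fun f => Finsupp.single (graft f T) (1 : k)), Phi_add,
    msum_GG]
  congr 1; funext A B
  rw [Phi_one, ← Phi_graftL T B 1]
  simp only [zero_add]
  refine msum_congr fun g _ => ?_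
  rw [graft, graftL_congr (pw 1 _ g) g T 1 (fun j h1 _ => by simp [pw]; omega)]
  simp [pw]

end graft

section ctx
variable {D : Type}

/-- One-hole contexts of subtrees. -/
inductive IsC : (LSub D → LSub D) → Prop
  | hole : IsC (fun x => x)
  | step (d : D) (pre post : List (LSub D)) (Y : LSub D → LSub D) :
      IsC Y → IsC (fun x => .mk d (pre ++ Y x :: post))

/-- One-hole contexts of forests. -/
def IsK (K : LSub D → List (LSub D)) : Prop :=
  ∃ (pre : List (LSub D)) (Y : LSub D → LSub D) (post : List (LSub D)),
    IsC Y ∧ K = fun x => pre ++ Y x :: post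

theorem IsK.mk (d : D) {K : LSub D → List (LSub D)} (h : IsK K) :
    IsC (fun x => LSub.mk d (K x)) := by
  obtain ⟨pre, Y, post, hY, rfl⟩ := h
  exact IsC.step d pre post Y hY

theorem IsK.pre (A : List (LSub D)) {K : LSub D → List (LSub D)} (h : IsK K) :
    IsK (fun x => A ++ K x) := by
  obtain ⟨pre, Y, post, hY, rfl⟩ := h
  exact ⟨A ++ pre, Y, post, hY, by funext x; simp⟩

theorem IsC.comp {Y Z : LSub D → LSub D} (hY : IsC Y) (hZ : IsC Z) :
    IsC (fun x => Y (Z x)) := by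
  induction hY with
  | hole => exact hZ
  | step d pre post Y _ ih => exact IsC.step d pre post _ ih

theorem IsK.comp {K : LSub D → List (LSub D)} {Z : LSub D → LSub D} (hK : IsK K) (hZ : IsC Z) :
    IsK (fun x => K (Z x)) := by
  obtain ⟨pre, Y, post, hY, rfl⟩ := hK
  exact ⟨pre, _, post, hY.comp hZ, rfl⟩

theorem ctx_of_pos (T : List (LSub D)) (i : ℕ) (p : List ℕ) (D₀ : D) (Ti : List (LSub D))
    (h : subAtL T i p = some (.mk D₀ Ti)) :
    ∃ K, IsK K ∧ T = K (.mk D₀ Ti) ∧ ∀ E q, replaceAtL E q T i p = K (.mk E q) := by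
  induction T, i, p using subAtL.induct with
  | case1 => simp [subAtL] at h
  | case2 t ts =>
    simp only [subAtL, Option.some.injEq] at h
    subst h
    exact ⟨fun x => [] ++ x :: ts, ⟨[], _, ts, IsC.hole, rfl⟩, rfl, fun E q => by
      simp [replaceAtL]⟩
  | case3 d cs ts j p ih =>
    simp only [subAtL] at h
    obtain ⟨K, hK, h1, h2⟩ := ih h
    refine ⟨fun x => [] ++ LSub.mk d (K x) :: ts, ⟨[], _, ts, hK.mk d, rfl⟩, ?_, fun E q => ?_⟩
    · simp [← h1]
    · simp [replaceAtL, h2]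
  | case4 t ts i p ih =>
    simp only [subAtL] at h
    obtain ⟨K, hK, h1, h2⟩ := ih h
    refine ⟨fun x => [t] ++ K x, hK.pre [t], ?_, fun E q => ?_⟩
    · simp [← h1]
    · simp [replaceAtL, h2]

theorem subAtL_append (pre L : List (LSub D)) (p : List ℕ) :
    subAtL (pre ++ L) pre.length p = subAtL L 0 p := by
  induction pre with
  | nil => rfl
  | cons a pre ih => simpa [subAtL] using ih

theorem replaceAtL_append (E : D) (q pre L : List (LSub D)) (p : List ℕ) :
    replaceAtL E q (pre ++ L) pre.length p = pre ++ replaceAtL E q L 0 p := by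
  induction pre with
  | nil => rfl
  | cons a pre ih => simpa [replaceAtL] using ih

theorem pos_of_ctx {Y : LSub D → LSub D} (hY : IsC Y) :
    ∃ p : List ℕ, ∀ (pre post : List (LSub D)) (G : D) (T' : List (LSub D)),
      subAtL (pre ++ Y (.mk G T') :: post) pre.length p = some (.mk G T') ∧
      ∀ E q, replaceAtL E q (pre ++ Y (.mk G T') :: post) pre.length p
        = pre ++ Y (.mk E q) :: post := by
  induction hY with
  | hole =>
    refine ⟨[], fun pre post G T' => ⟨?_, fun E q => ?_⟩⟩
    · rw [subAtL_append]; simp [subAtL]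
    · rw [replaceAtL_append]; simp [replaceAtL]
  | step d pre' post' Y _ ih =>
    obtain ⟨p, hp⟩ := ih
    refine ⟨pre'.length :: p, fun pre post G T' => ⟨?_, fun E q => ?_⟩⟩
    · rw [subAtL_append]; simp only [subAtL]; exact (hp _ _ _ _).1
    · rw [replaceAtL_append]; simp only [replaceAtL]; rw [(hp _ _ _ _).2]

theorem msum_GrL_append {M : Type} [AddCommMonoid M] (pre ts W : List (LSub D))
    (F : List (LSub D) → M) :
    msum (GrL (pre ++ ts) W) F = sps W (fun A B => msum (GrL pre A) (fun P =>
      msum (GrL ts B) (fun T => F (P ++ T)))) := by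
  classical
  induction pre generalizing W F with
  | nil =>
    simp only [msum_GrL_nil, List.nil_append]
    rw [sps_nil_left W (fun B => msum (GrL ts B) F)]
  | cons t pre ih =>
    simp only [List.cons_append, msum_GrL_cons, ih]
    rw [sps_coassoc W (fun C D B => msum (GrS t C) fun t' => msum (GrL pre D) fun P =>
      msum (GrL ts B) fun T => F (t' :: (P ++ T)))]
    simp only [sps_msum]

/-- The grafting expansion around a hole. -/
def CtxExp {β : Type} (mul : (LSub D) → List (LSub D) → Multiset β)
    (C : List (LSub D) → Multiset (LSub D → β)) : Prop :=
  ∀ (M : Type) [AddCommMonoid M] (W : List (LSub D)) (G : D) (Ti : List (LSub D)) (F : β → M),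
    msum (mul (.mk G Ti) W) F = sps W (fun A B => msum (GG Ti A) (fun T' =>
      msum (C B) (fun Y' => F (Y' (.mk G T')))))

theorem ctx_GG (pre post : List (LSub D)) (Y : LSub D → LSub D)
    (C : List (LSub D) → Multiset (LSub D → LSub D)) (hC : ∀ B, ∀ Y' ∈ C B, IsC Y')
    (h : CtxExp (fun x => GrS (Y x)) C) :
    ∃ C' : List (LSub D) → Multiset (LSub D → List (LSub D)), (∀ B, ∀ K ∈ C' B, IsK K) ∧
      CtxExp (fun x => GG (pre ++ Y x :: post)) C' := by
  refine ⟨fun Z => (↑(splits Z) : Multiset (List (LSub D) × List (LSub D))).bind fun a =>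
    (↑(splits a.2) : Multiset (List (LSub D) × List (LSub D))).bind fun b =>
    (↑(splits b.2) : Multiset (List (LSub D) × List (LSub D))).bind fun c =>
    (GrL pre b.1).bind fun p => (C c.1).bind fun y => (GrL post c.2).map fun q =>
      fun x => a.1 ++ (p ++ y x :: q), ?_, ?_⟩
  · intro B K hK
    simp only [Multiset.mem_bind, Multiset.mem_map] at hK
    obtain ⟨a, -, b, -, c, -, p, -, y, hy, q, -, rfl⟩ := hK
    exact IsK.pre _ ⟨p, y, q, hC _ _ hy, rfl⟩
  · intro M _ W G Ti F
    have h' := h M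
    simp only at h'
    simp only [msum_GG (pre ++ Y _ :: post), msum_GrL_append, msum_GrL_cons, h', msum_bind, msum_map]
    have e1 : ∀ (A B : List (LSub D)),
        (sps B fun P B' => msum (GrL pre P) fun p => sps B' fun B2 Q => sps B2 fun A' Yb =>
          msum (GG Ti A') fun T' => msum (C Yb) fun y => msum (GrL post Q) fun q =>
            F (A ++ (p ++ y (.mk G T') :: q)))
        = sps B fun A' S => sps S fun P R => sps R fun Yb Q =>
          msum (GG Ti A') fun T' => msum (GrL pre P) fun p => msum (C Yb) fun y =>
            msum (GrL post Q) fun q => F (A ++ (p ++ y (.mk G T') :: q)) := by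
      intro A B
      rw [sps_leftcomm B (fun A' P R => sps R fun Yb Q =>
          msum (GG Ti A') fun T' => msum (GrL pre P) fun p => msum (C Yb) fun y =>
            msum (GrL post Q) fun q => F (A ++ (p ++ y (.mk G T') :: q)))]
      congr 1; funext P B'
      rw [← sps_coassoc B' (fun A' Yb Q => msum (GG Ti A') fun T' => msum (GrL pre P) fun p =>
        msum (C Yb) fun y => msum (GrL post Q) fun q => F (A ++ (p ++ y (.mk G T') :: q)))]
      simp_rw [msum_comm (GG Ti _) (GrL pre P)]
      simp only [sps_msum]
    simp only [e1]
    rw [sps_leftcomm W (fun A A' S => sps S fun P R => sps R fun Yb Q =>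
          msum (GG Ti A') fun T' => msum (GrL pre P) fun p => msum (C Yb) fun y =>
            msum (GrL post Q) fun q => F (A ++ (p ++ y (.mk G T') :: q)))]
    change _ = sps W fun A' Z => msum (GG Ti A') fun T' => sps Z fun A S => sps S fun P R =>
      sps R fun Yb Q => msum (GrL pre P) fun p => msum (C Yb) fun y =>
        msum (GrL post Q) fun q => F (A ++ (p ++ y (.mk G T') :: q))
    simp only [sps_msum]

theorem ctx_GrS {Y : LSub D → LSub D} (hY : IsC Y) :
    ∃ C : List (LSub D) → Multiset (LSub D → LSub D), (∀ B, ∀ Y' ∈ C B, IsC Y') ∧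
      CtxExp (fun x => GrS (Y x)) C := by
  classical
  induction hY with
  | hole =>
    refine ⟨fun B => if B = [] then {fun x => x} else 0, ?_, ?_⟩
    · intro B Y' h
      dsimp only at h
      split_ifs at h
      · rw [Multiset.mem_singleton.1 h]; exact IsC.hole
      · simp at h
    · intro M _ W G Ti F
      simp only [msum_GrS]
      rw [← sps_nil_right W (fun A => msum (GG Ti A) fun T => F (.mk G T))]
      congr 1; funext A B
      split_ifs <;> simp [msum]
  | step d pre post Y _ ih =>
    obtain ⟨C, hC, h⟩ := ih
    obtain ⟨C', hC', h'⟩ := ctx_GG pre post Y C hC h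
    refine ⟨fun B => (C' B).map fun K x => .mk d (K x), ?_, ?_⟩
    · intro B Y' hY'
      obtain ⟨K, hK, rfl⟩ := Multiset.mem_map.1 hY'
      exact (hC' B K hK).mk d
    · intro M _ W G Ti F
      have := h' M W G Ti (fun T => F (.mk d T))
      simp only [msum_GrS, msum_map]
      exact this

theorem ctx_K {K : LSub D → List (LSub D)} (hK : IsK K) :
    ∃ C' : List (LSub D) → Multiset (LSub D → List (LSub D)), (∀ B, ∀ K ∈ C' B, IsK K) ∧
      CtxExp (fun x => GG (K x)) C' := by
  obtain ⟨pre, Y, post, hY, rfl⟩ := hK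
  obtain ⟨C, hC, h⟩ := ctx_GrS hY
  exact ctx_GG pre post Y C hC h

theorem sps_interchange {α M : Type} [AddCommMonoid M] (W : List α)
    (H : List α → List α → List α → List α → M) :
    sps W (fun A B => sps A (fun C₁ C₂ => sps B (fun B₁ B₂ => H C₁ C₂ B₁ B₂))) =
      sps W (fun A B => sps A (fun C₁ B₁ => sps B (fun C₂ B₂ => H C₁ C₂ B₁ B₂))) := by
  rw [sps_coassoc W (fun C₁ C₂ B => sps B (fun B₁ B₂ => H C₁ C₂ B₁ B₂)),
    sps_coassoc W (fun C₁ B₁ B => sps B (fun C₂ B₂ => H C₁ C₂ B₁ B₂))]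
  congr 1; funext C₁ S
  exact sps_leftcomm S (fun C₂ B₁ B₂ => H C₁ C₂ B₁ B₂)

theorem delta_GrL {M : Type} [AddCommMonoid M] (T W : List (LSub D))
    (H : List (LSub D) → List (LSub D) → M) :
    msum (GrL T W) (fun T' => sps T' H) = sps W (fun A B => sps T (fun q₁ q₂ =>
      msum (GrL q₁ A) (fun U => msum (GrL q₂ B) (fun V => H U V)))) := by
  classical
  induction T generalizing W H with
  | nil =>
    simp only [msum_GrL_nil, sps_nil]
    rw [← sps_nil_left W (fun B => if B = [] then H [] [] else 0)]
  | cons t T ih =>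
    simp only [msum_GrL_cons, sps_cons, sps_add, msum_add, ih]
    congr 1
    · simp only [← sps_msum]
      simp_rw [sps_sps T]
      rw [sps_coassoc W (fun C D B => sps T fun q₁ q₂ => msum (GrS t C) fun t' =>
        msum (GrL q₁ D) fun U => msum (GrL q₂ B) fun V => H (t' :: U) V)]
    · simp only [← sps_msum]
      simp_rw [sps_sps T, msum_comm (GrL _ _) (GrS t _)]
      rw [sps_leftcomm W (fun A C D => sps T fun q₁ q₂ => msum (GrS t C) fun t' =>
        msum (GrL q₁ A) fun U => msum (GrL q₂ D) fun V => H U (t' :: V))]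

theorem delta_GG {M : Type} [AddCommMonoid M] (T W : List (LSub D))
    (H : List (LSub D) → List (LSub D) → M) :
    msum (GG T W) (fun T' => sps T' H) = sps W (fun A B => sps T (fun q₁ q₂ =>
      msum (GG q₁ A) (fun U => msum (GG q₂ B) (fun V => H U V)))) := by
  simp only [msum_GG, sps_append]
  simp only [← sps_msum, delta_GrL]
  rw [sps_interchange W (fun C₁ C₂ B₁ B₂ => sps T fun q₁ q₂ => msum (GrL q₁ B₁) fun U =>
    msum (GrL q₂ B₂) fun V => H (C₁ ++ U) (C₂ ++ V))]
  simp_rw [sps_sps T]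

end ctx

section ins
variable {D M X : Type} [AddCommMonoid M] (P : AddSubmonoid (X → M))

theorem msum_mem {m : Multiset D} {F : D → X → M} (h : ∀ a ∈ m, F a ∈ P) :
    (fun x => msum m (fun a => F a x)) ∈ P := by
  have : (fun x => msum m (fun a => F a x)) = (m.map F).sum := by
    funext x
    have := map_multiset_sum (Pi.evalAddMonoidHom (fun _ : X => M) x) (m.map F)
    simp only [Pi.evalAddMonoidHom_apply, Multiset.map_map] at this
    rw [this]; rfl
  rw [this]
  exact AddSubmonoid.multiset_sum_mem _ _ (by
    intro y hy
    obtain ⟨a, ha, rfl⟩ := Multiset.mem_map.1 hy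
    exact h a ha)

theorem sps_mem {W : List D} {H : List D → List D → X → M} (h : ∀ A B, H A B ∈ P) :
    (fun x => sps W (fun A B => H A B x)) ∈ P := msum_mem P (fun q _ => h q.1 q.2)

theorem add_mem_fun {f g : X → M} (hf : f ∈ P) (hg : g ∈ P) : (fun x => f x + g x) ∈ P :=
  P.add_mem hf hg

theorem sps_insert {α : Type} (V W : List α) (y : X → α) (H : List α → List α → M)
    (h1 : ∀ V₁ V₂ W₁ W₂, (fun x => H (V₁ ++ y x :: W₁) (V₂ ++ W₂)) ∈ P)
    (h2 : ∀ V₁ V₂ W₁ W₂, (fun x => H (V₁ ++ W₁) (V₂ ++ y x :: W₂)) ∈ P) :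
    (fun x => sps (V ++ y x :: W) H) ∈ P := by
  simp only [sps_append, sps_cons]
  refine sps_mem P fun V₁ V₂ => ?_
  exact add_mem_fun P (sps_mem P fun W₁ W₂ => h1 _ _ _ _) (sps_mem P fun W₁ W₂ => h2 _ _ _ _)

theorem ins_GG_aux (T : List (LSub D)) (y : X → LSub D)
    (ih : ∀ (V W : List (LSub D)) (F : List (LSub D) → M),
      (∀ K, IsK K → (fun x => F (K (y x))) ∈ P) →
      (fun x => msum (GrL T (V ++ y x :: W)) F) ∈ P)
    (V W : List (LSub D)) (F : List (LSub D) → M)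
    (h : ∀ K, IsK K → (fun x => F (K (y x))) ∈ P) :
    (fun x => msum (GG T (V ++ y x :: W)) F) ∈ P := by
  simp only [msum_GG]
  refine sps_insert P V W y (fun A B => msum (GrL T B) fun T' => F (A ++ T')) ?_ ?_
  · intro V₁ V₂ W₁ W₂
    refine msum_mem P fun T' _ => ?_
    have := h (fun x => V₁ ++ x :: (W₁ ++ T')) ⟨V₁, _, _, IsC.hole, rfl⟩
    simpa using this
  · intro V₁ V₂ W₁ W₂
    exact ih _ _ _ fun K hK => h _ (hK.pre _)

mutual
  theorem ins_GrS (t : LSub D) (y : X → LSub D) (V W : List (LSub D)) (F : LSub D → M)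
      (h : ∀ Y, IsC Y → (fun x => F (Y (y x))) ∈ P) :
      (fun x => msum (GrS t (V ++ y x :: W)) F) ∈ P := by
    match t with
    | .mk d ts =>
      simp only [msum_GrS]
      exact ins_GG_aux P ts y (fun V W F h => ins_GrL ts y V W F h) V W (fun T => F (.mk d T))
        (fun K hK => h _ (hK.mk d))
  theorem ins_GrL (T : List (LSub D)) (y : X → LSub D) (V W : List (LSub D))
      (F : List (LSub D) → M) (h : ∀ K, IsK K → (fun x => F (K (y x))) ∈ P) :
      (fun x => msum (GrL T (V ++ y x :: W)) F) ∈ P := by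
    classical
    match T with
    | [] =>
      simp only [msum_GrL_nil]
      simp only [List.append_eq_nil_iff, reduceCtorEq, and_false, if_false]
      exact P.zero_mem
    | t :: ts =>
      simp only [msum_GrL_cons]
      refine sps_insert P V W y (fun A B => msum (GrS t A) fun t' => msum (GrL ts B) fun T' =>
        F (t' :: T')) ?_ ?_
      · intro V₁ V₂ W₁ W₂
        refine ins_GrS t y V₁ W₁ _ fun Y hY => ?_
        refine msum_mem P fun T' _ => ?_
        exact h (fun x => [] ++ Y x :: T') ⟨[], Y, T', hY, rfl⟩
      · intro V₁ V₂ W₁ W₂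
        refine msum_mem P fun t' _ => ?_
        exact ins_GrL ts y _ _ (fun T' => F (t' :: T')) fun K hK => h _ (hK.pre [t'])
end

theorem ins_GG (T : List (LSub D)) (y : X → LSub D) (V W : List (LSub D))
    (F : List (LSub D) → M)
    (h : ∀ K, IsK K → (fun x => F (K (y x))) ∈ P) :
    (fun x => msum (GG T (V ++ y x :: W)) F) ∈ P :=
  ins_GG_aux P T y (fun V W F h => ins_GrL P T y V W F h) V W F h

end ins

section main
variable {k R : Type} [Field k] [CommRing R] [Algebra k R]
variable {act : LTree (Derivation k R R) → R → R}

theorem act_add (hact : IsTreeAction k R act) (T : LTree (Derivation k R R)) (f g : R) :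
    act T (f + g) = act T f + act T g := by
  have := hact.2.1 T 1 f g
  simpa using this

theorem act_zero (hact : IsTreeAction k R act) (T : LTree (Derivation k R R)) : act T 0 = 0 := by
  have := act_add hact T 0 0
  simpa using this

theorem act_mul (hact : IsTreeAction k R act) (T : LTree (Derivation k R R)) (f g : R) :
    act T (f * g) = sps T (fun A B => act A f * act B g) := by
  rw [hact.2.2.2, sps_eq T (fun A B => act A f * act B g)]

theorem act_act (hact : IsTreeAction k R act) (T₁ T₂ : LTree (Derivation k R R)) (f : R) :
    act T₁ (act T₂ f) = msum (GG T₂ T₁) (fun T => act T f) := by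
  rw [← hact.2.2.1, mulT_eq]
  have := msum_hom (Finsupp.linearCombination k (fun T => act T f)).toAddMonoidHom (GG T₂ T₁)
    (fun T' => Finsupp.single T' (1 : k))
  simp only [LinearMap.toAddMonoidHom_coe, Finsupp.linearCombination_single, one_smul] at this
  exact this

theorem splits_length {α : Type} (W : List α) :
    ∀ q ∈ splits W, q.1.length ≤ W.length ∧ q.2.length ≤ W.length := by
  induction W with
  | nil => simp [splits]
  | cons a W ih =>
    intro q hq
    simp only [splits, List.mem_append, List.mem_map] at hq
    rcases hq with ⟨p, hp, rfl⟩ | ⟨p, hp, rfl⟩ <;> have := ih p hp <;> simp <;> omega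

theorem act_one_aux (hact : IsTreeAction k R act) (n : ℕ) :
    ∀ T : LTree (Derivation k R R), T.length = n + 1 → act T 1 = 0 := by
  classical
  induction n using Nat.strong_induction_on with
  | _ n ih =>
    intro T hT
    match T with
    | [] => simp at hT
    | t :: ts =>
      have hlen : ts.length = n := by simpa using hT
      have key : ∀ q ∈ splits ts, act q.1 1 = (if q.1 = [] then 1 else 0) ∧
          act q.2 1 = (if q.2 = [] then 1 else 0) := by
        intro q hq
        have hl := splits_length ts q hq
        have aux : ∀ A : LTree (Derivation k R R), A.length ≤ n →
            act A 1 = if A = [] then 1 else 0 := by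
          intro A hA
          match A with
          | [] => simp [hact.1]
          | a :: A =>
            simp only [reduceCtorEq, if_false]
            simp only [List.length_cons] at hA
            exact ih A.length (by omega) _ (by simp)
        exact ⟨aux _ (by omega), aux _ (by omega)⟩
      have h := act_mul hact (t :: ts) 1 1
      rw [sps_cons, mul_one] at h
      have e1 : sps ts (fun A B => act (t :: A) 1 * act B 1) = act (t :: ts) 1 := by
        rw [← sps_nil_right ts (fun A => act (t :: A) 1)]
        refine msum_congr fun q hq => ?_
        have hk := (key q (by simpa using hq)).2
        simp only [hk]; simp
      have e2 : sps ts (fun A B => act A 1 * act (t :: B) 1) = act (t :: ts) 1 := by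
        rw [← sps_nil_left ts (fun A => act (t :: A) 1)]
        refine msum_congr fun q hq => ?_
        have hk := (key q (by simpa using hq)).1
        simp only [hk]; simp
      rw [e1, e2] at h
      simpa using h

theorem act_one (hact : IsTreeAction k R act) (T : LTree (Derivation k R R))
    [Decidable (T = [])] : act T 1 = if T = [] then 1 else 0 := by
  cases T with
  | nil => simp [hact.1]
  | cons t ts => simpa using act_one_aux hact ts.length (t :: ts) (by simp)

theorem gen_mem {K : LSub (Derivation k R R) → LTree (Derivation k R R)} (hK : IsK K)
    (r : R) (E : Derivation k R R) (Ti : LTree (Derivation k R R)) :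
    Finsupp.single (K (.mk (r • E) Ti)) (1 : R) -
      sps Ti (fun u₁ u₂ => Finsupp.single (K (.mk E u₂)) (act u₁ r)) ∈
      Submodule.span R (leibnizGens k R act) := by
  obtain ⟨pre, Y, post, hY, rfl⟩ := hK
  obtain ⟨p, hp⟩ := pos_of_ctx hY
  refine Submodule.subset_span ⟨_, pre.length, p, r • E, Ti, r, E, (hp pre post _ _).1, rfl, ?_⟩
  rw [← sps_eq]
  simp only [(hp pre post _ _).2]

theorem gens_ctx {z} (hz : z ∈ leibnizGens k R act) :
    ∃ (K : LSub (Derivation k R R) → LTree (Derivation k R R)) (r : R) (E : Derivation k R R)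
      (Ti : LTree (Derivation k R R)), IsK K ∧
      z = Finsupp.single (K (.mk (r • E) Ti)) (1 : R) -
        sps Ti (fun u₁ u₂ => Finsupp.single (K (.mk E u₂)) (act u₁ r)) := by
  obtain ⟨T, i, p, D₀, Ti, r, E, h, rfl, rfl⟩ := hz
  obtain ⟨K, hK, h1, h2⟩ := ctx_of_pos T i p _ _ h
  refine ⟨K, r, E, Ti, hK, ?_⟩
  rw [← sps_eq, ← h1]
  simp only [h2]

theorem leib_ctx (hleib : IsLeibnitz k R act)
    {K : LSub (Derivation k R R) → LTree (Derivation k R R)} (hK : IsK K)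
    (r : R) (E : Derivation k R R) (Ti : LTree (Derivation k R R)) (s : R) :
    act (K (.mk (r • E) Ti)) s = sps Ti (fun u₁ u₂ => act u₁ r * act (K (.mk E u₂)) s) := by
  obtain ⟨pre, Y, post, hY, rfl⟩ := hK
  obtain ⟨p, hp⟩ := pos_of_ctx hY
  rw [hleib _ pre.length p _ Ti (hp pre post _ _).1 r E rfl s, ← sps_eq]
  simp only [(hp pre post _ _).2]

/-- Product of monomials. -/
noncomputable def mon (act : LTree (Derivation k R R) → R → R) (T : LTree (Derivation k R R))
    (r : R) (T' : LTree (Derivation k R R)) (s : R) : LTree (Derivation k R R) →₀ R :=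
  sps T (fun A B => (r * act A s) • mulT R B T')

theorem smash_eq (x y : LTree (Derivation k R R) →₀ R) :
    smashMulS k R act x y = x.sum fun T r => y.sum fun T' s => mon act T r T' s := by
  simp only [smashMulS, mon]
  simp only [← sps_eq]

theorem mon_add_left (T T' : LTree (Derivation k R R)) (r r' s : R) :
    mon act T (r + r') T' s = mon act T r T' s + mon act T r' T' s := by
  simp only [mon, add_mul, add_smul, sps_add]

theorem mon_zero_left (T T' : LTree (Derivation k R R)) (s : R) :
    mon act T 0 T' s = 0 := by
  simp only [mon, zero_mul, zero_smul, sps_zero]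

theorem mon_add_right (hact : IsTreeAction k R act) (T T' : LTree (Derivation k R R))
    (r s s' : R) : mon act T r T' (s + s') = mon act T r T' s + mon act T r T' s' := by
  simp only [mon, act_add hact, mul_add, add_smul, sps_add]

theorem mon_zero_right (hact : IsTreeAction k R act) (T T' : LTree (Derivation k R R)) (r : R) :
    mon act T r T' 0 = 0 := by
  simp only [mon, act_zero hact, mul_zero, zero_smul, sps_zero]

theorem smash_add_left (x x' y : LTree (Derivation k R R) →₀ R) :
    smashMulS k R act (x + x') y = smashMulS k R act x y + smashMulS k R act x' y := by
  classical
  simp only [smash_eq]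
  refine Finsupp.sum_add_index' (fun T => ?_) (fun T r r' => ?_)
  · simp only [mon_zero_left, Finsupp.sum, Finset.sum_const_zero]
  · simp only [mon_add_left, Finsupp.sum_add]

theorem smash_add_right (hact : IsTreeAction k R act) (x y y' : LTree (Derivation k R R) →₀ R) :
    smashMulS k R act x (y + y') = smashMulS k R act x y + smashMulS k R act x y' := by
  classical
  simp only [smash_eq]
  rw [← Finsupp.sum_add]
  congr 1; funext T r
  exact Finsupp.sum_add_index' (fun T' => mon_zero_right hact _ _ _)
    (fun T' s s' => mon_add_right hact _ _ _ _ _)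

theorem smash_single (hact : IsTreeAction k R act) (T T' : LTree (Derivation k R R)) (r s : R) :
    smashMulS k R act (Finsupp.single T r) (Finsupp.single T' s) = mon act T r T' s := by
  rw [smash_eq, Finsupp.sum_single_index, Finsupp.sum_single_index]
  · exact mon_zero_right hact _ _ _
  · simp only [mon_zero_left, Finsupp.sum, Finset.sum_const_zero]

/-- Left multiplication as an additive map. -/
noncomputable def lmulH (hact : IsTreeAction k R act) (x : LTree (Derivation k R R) →₀ R) :
    (LTree (Derivation k R R) →₀ R) →+ (LTree (Derivation k R R) →₀ R) :=
  AddMonoidHom.mk' (fun y => smashMulS k R act x y) (smash_add_right hact x)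

/-- Right multiplication as an additive map. -/
noncomputable def rmulH (act : LTree (Derivation k R R) → R → R)
    (y : LTree (Derivation k R R) →₀ R) :
    (LTree (Derivation k R R) →₀ R) →+ (LTree (Derivation k R R) →₀ R) :=
  AddMonoidHom.mk' (fun x => smashMulS k R act x y) (fun x x' => smash_add_left x x' y)

theorem smash_smul_left (a : R) (x y : LTree (Derivation k R R) →₀ R) :
    smashMulS k R act (a • x) y = a • smashMulS k R act x y := by
  have h0 : smashMulS k R act 0 y = 0 := map_zero (rmulH act y)
  induction x using Finsupp.induction_linear with
  | zero => rw [smul_zero, h0, smul_zero]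
  | add x x' hx hx' => rw [smul_add, smash_add_left, hx, hx', smash_add_left, smul_add]
  | single T r =>
    rw [Finsupp.smul_single, smash_eq, smash_eq, Finsupp.sum_single_index,
      Finsupp.sum_single_index, Finsupp.smul_sum]
    · congr 1; funext T' s
      have := sps_hom (DistribSMul.toAddMonoidHom (LTree (Derivation k R R) →₀ R) a) T
        (fun A B => (r * act A s) • mulT R B T')
      simp only [DistribSMul.toAddMonoidHom_apply] at this
      simp only [mon, this, smul_smul, smul_eq_mul, mul_assoc]
    all_goals simp only [mon_zero_left, Finsupp.sum, Finset.sum_const_zero]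

theorem smash_smul_right (hact : IsTreeAction k R act) (W : LTree (Derivation k R R)) (s a : R)
    (y : LTree (Derivation k R R) →₀ R) :
    smashMulS k R act (Finsupp.single W s) (a • y) =
      sps W (fun A B => smashMulS k R act (Finsupp.single B (s * act A a)) y) := by
  have h0 : ∀ x, smashMulS k R act x 0 = 0 := fun x => map_zero (lmulH hact x)
  induction y using Finsupp.induction_linear with
  | zero => simp only [smul_zero, h0, sps_zero]
  | add x x' hx hx' => simp only [smul_add, smash_add_right hact, hx, hx', sps_add]
  | single T c =>
    simp only [Finsupp.smul_single, smash_single hact, mon, smul_eq_mul, act_mul hact]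
    rw [← sps_coassoc W (fun A C D => (s * act A a * act C c) • mulT R D T)]
    congr 1; funext A B
    have := sps_hom (((LinearMap.toSpanSingleton R _ (mulT R B T)).toAddMonoidHom).comp
      (AddMonoidHom.mulLeft s)) A (fun A' B' => act A' a * act B' c)
    simp only [AddMonoidHom.comp_apply, AddMonoidHom.coe_mulLeft,
      LinearMap.toAddMonoidHom_coe, LinearMap.toSpanSingleton_apply] at this
    rw [this]
    simp only [mul_assoc]

theorem msum_mem' {α N : Type} [AddCommMonoid N] (P : AddSubmonoid N) {m : Multiset α} {F : α → N}
    (h : ∀ a ∈ m, F a ∈ P) : msum m F ∈ P := by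
  refine AddSubmonoid.multiset_sum_mem _ _ fun y hy => ?_
  obtain ⟨a, ha, rfl⟩ := Multiset.mem_map.1 hy
  exact h a ha

theorem msum_sub {α N : Type} [AddCommGroup N] (m : Multiset α) (F G : α → N) :
    msum m (fun a => F a - G a) = msum m F - msum m G := by
  simp [msum]

theorem smul_msum {α N : Type} [AddCommMonoid N] [Module R N] (a : R) (m : Multiset α)
    (F : α → N) : a • msum m F = msum m (fun b => a • F b) :=
  msum_hom (DistribSMul.toAddMonoidHom N a) m F

theorem single_msum {α : Type} (m : Multiset α) (T : LTree (Derivation k R R)) (F : α → R) :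
    (Finsupp.single T (msum m F) : LTree (Derivation k R R) →₀ R) =
      msum m (fun b => Finsupp.single T (F b)) :=
  msum_hom (Finsupp.singleAddHom T) m F

theorem left_gen (hact : IsTreeAction k R act) {z : LTree (Derivation k R R) →₀ R}
    (hz : z ∈ leibnizGens k R act) (W : LTree (Derivation k R R)) (s : R) :
    smashMulS k R act (Finsupp.single W s) z ∈ Submodule.span R (leibnizGens k R act) := by
  classical
  obtain ⟨K, r, E, Ti, hK, rfl⟩ := gens_ctx hz
  have hs : (Finsupp.single W s : LTree (Derivation k R R) →₀ R) = s • Finsupp.single W 1 := by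
    simp
  rw [hs, smash_smul_left]
  refine Submodule.smul_mem _ _ ?_
  change lmulH hact _ _ ∈ _
  rw [map_sub, sps_hom]
  change smashMulS k R act _ _ - sps Ti (fun A B => smashMulS k R act _ _) ∈ _
  simp only [smash_single hact, mon, one_mul]
  obtain ⟨C, hC, hexp⟩ := ctx_K hK
  have hexp' := hexp (LTree (Derivation k R R) →₀ R)
  simp only at hexp'
  have e1 : sps W (fun A B => act A 1 • mulT R B (K (.mk (r • E) Ti))) =
      sps W (fun A B => msum (GG Ti A) (fun T' => msum (C B) (fun K' =>
        Finsupp.single (K' (.mk (r • E) T')) (1 : R)))) := by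
    simp only [act_one hact, ite_smul, one_smul, zero_smul]
    rw [sps_nil_left W (fun B => mulT R B (K (.mk (r • E) Ti))), mulT_eq, hexp']
  have e2 : sps Ti (fun u₁ u₂ => sps W (fun A B => act A (act u₁ r) • mulT R B (K (.mk E u₂)))) =
      sps W (fun A B => msum (GG Ti A) (fun T' => msum (C B) (fun K' =>
        sps T' (fun u₁ u₂ => Finsupp.single (K' (.mk E u₂)) (act u₁ r))))) := by
    simp_rw [msum_comm (GG Ti _) (C _), delta_GG, ← sps_msum, sps_sps Ti]
    rw [sps_coassoc W (fun A₁ A₂ B => sps Ti fun q₁ q₂ => msum (C B) fun K' =>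
      msum (GG q₁ A₁) fun U => msum (GG q₂ A₂) fun V =>
        Finsupp.single (K' (.mk E V)) (act U r))]
    simp_rw [sps_sps _ Ti]
    congr 1; funext q₁ q₂
    congr 1; funext A B
    rw [mulT_eq, hexp', act_act hact]
    simp only [sps, smul_msum]
    refine msum_congr fun q _ => ?_
    rw [msum_comm]
    refine msum_congr fun K' _ => ?_
    rw [msum_comm]
    refine msum_congr fun V _ => ?_
    rw [Finsupp.smul_single, smul_eq_mul, mul_one, single_msum]
  rw [e1, e2]
  simp only [sps, ← msum_sub]
  refine msum_mem' (Submodule.toAddSubmonoid _) fun q _ => ?_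
  refine msum_mem' (Submodule.toAddSubmonoid _) fun T' _ => ?_
  refine msum_mem' (Submodule.toAddSubmonoid _) fun K' hK' => ?_
  have hmem := hC _ _ hK'
  exact gen_mem hmem r E _

/-- The Leibnitz defect of a function of the subtree. -/
noncomputable def defect (act : LTree (Derivation k R R) → R → R) (r : R)
    (E : Derivation k R R) (Ti : LTree (Derivation k R R)) :
    (LSub (Derivation k R R) → (LTree (Derivation k R R) →₀ R)) →+
      (LTree (Derivation k R R) →₀ R) :=
  AddMonoidHom.mk' (fun Φ => Φ (.mk (r • E) Ti) - sps Ti (fun u₁ u₂ => act u₁ r • Φ (.mk E u₂)))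
    (by
      intro Φ Ψ
      simp only [Pi.add_apply, smul_add, sps_add]
      abel)

theorem right_gen (hact : IsTreeAction k R act) (hleib : IsLeibnitz k R act)
    {z : LTree (Derivation k R R) →₀ R}
    (hz : z ∈ leibnizGens k R act) (W : LTree (Derivation k R R)) (s : R) :
    smashMulS k R act z (Finsupp.single W s) ∈ Submodule.span R (leibnizGens k R act) := by
  obtain ⟨K, r, E, Ti, hK, rfl⟩ := gens_ctx hz
  change rmulH act _ _ ∈ _
  rw [map_sub, sps_hom]
  change smashMulS k R act _ _ - sps Ti (fun A B => smashMulS k R act _ _) ∈ _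
  have hs : ∀ u₁ u₂, smashMulS k R act (Finsupp.single (K (.mk E u₂)) (act u₁ r))
      (Finsupp.single W s) = act u₁ r • mon act (K (.mk E u₂)) 1 W s := by
    intro u₁ u₂
    rw [← smash_single hact, ← smash_smul_left]; simp
  simp only [hs]
  rw [smash_single hact]
  let P : AddSubmonoid (LSub (Derivation k R R) → (LTree (Derivation k R R) →₀ R)) :=
    (Submodule.span R (leibnizGens k R act)).toAddSubmonoid.comap (defect act r E Ti)
  have memP : ∀ Φ, Φ ∈ P ↔ Φ (.mk (r • E) Ti) - sps Ti (fun u₁ u₂ => act u₁ r • Φ (.mk E u₂)) ∈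
      Submodule.span R (leibnizGens k R act) := fun Φ => Iff.rfl
  have smulP : ∀ (a : R) Φ, Φ ∈ P → (fun x => a • Φ x) ∈ P := by
    intro a Φ h
    rw [memP] at h ⊢
    have := Submodule.smul_mem _ a h
    rw [smul_sub] at this
    simp only [sps, smul_msum] at this ⊢
    simpa only [smul_smul, mul_comm] using this
  suffices h : (fun x => mon act (K x) 1 W s) ∈ P from h
  obtain ⟨pre, Y, post, hY, rfl⟩ := hK
  simp only [mon, one_mul]
  refine sps_insert P pre post Y (fun A B => act A s • mulT R B W) ?_ ?_
  · intro V₁ V₂ W₁ W₂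
    rw [memP]
    have := leib_ctx hleib ⟨V₁, Y, W₁, hY, rfl⟩ r E Ti s
    have e := sps_hom ((LinearMap.toSpanSingleton R _ (mulT R (V₂ ++ W₂) W)).toAddMonoidHom)
      Ti (fun u₁ u₂ => act u₁ r * act (V₁ ++ Y (.mk E u₂) :: W₁) s)
    simp only [LinearMap.toAddMonoidHom_coe, LinearMap.toSpanSingleton_apply] at e
    rw [this, e]
    simp only [smul_smul, sub_self]
    exact Submodule.zero_mem _
  · intro V₁ V₂ W₁ W₂
    refine smulP _ _ ?_
    simp only [mulT_eq]
    refine ins_GG P W Y V₂ W₂ _ fun K hK => ?_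
    rw [memP]
    simpa only [Finsupp.smul_single, smul_eq_mul, mul_one] using gen_mem (hK.comp hY) r E Ti

end main

end LeibAux

/-- **Lemma.** For a Leibnitz `kLT(𝔇)`-module algebra structure on `R`, the `R`-linear
span of the Leibnitz elements is a two-sided ideal in the smash product `R # kLT(𝔇)`. -/
theorem leibniz_span_is_two_sided_ideal
    (k R : Type) [Field k] [CommRing R] [Algebra k R]
    (act : LTree (Derivation k R R) → R → R)
    (hact : IsTreeAction k R act)
    (hleib : IsLeibnitz k R act) :
    ∀ z ∈ Submodule.span R (leibnizGens k R act),
      ∀ b : LTree (Derivation k R R) →₀ R,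
        smashMulS k R act b z ∈ Submodule.span R (leibnizGens k R act) ∧
        smashMulS k R act z b ∈ Submodule.span R (leibnizGens k R act) := by
  classical
  intro z hz b
  constructor
  · induction hz using Submodule.span_induction generalizing b with
    | mem z hz =>
      induction b using Finsupp.induction_linear with
      | zero => rw [show smashMulS k R act 0 z = 0 from map_zero (LeibAux.rmulH act z)]
                exact Submodule.zero_mem _
      | add b b' h h' => rw [LeibAux.smash_add_left]; exact Submodule.add_mem _ h h'
      | single W s => exact LeibAux.left_gen hact hz W s
    | zero =>
      rw [show smashMulS k R act b 0 = 0 from map_zero (LeibAux.lmulH hact b)]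
      exact Submodule.zero_mem _
    | add x y _ _ hx hy =>
      rw [LeibAux.smash_add_right hact]; exact Submodule.add_mem _ (hx b) (hy b)
    | smul a x _ hx =>
      induction b using Finsupp.induction_linear with
      | zero => rw [show smashMulS k R act 0 (a • x) = 0 from map_zero (LeibAux.rmulH act (a • x))]
                exact Submodule.zero_mem _
      | add b b' h h' => rw [LeibAux.smash_add_left]; exact Submodule.add_mem _ h h'
      | single W s =>
        rw [LeibAux.smash_smul_right hact]
        exact LeibAux.msum_mem' (Submodule.toAddSubmonoid _) fun q _ => hx
          (Finsupp.single q.2 (s * act q.1 a))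
  · induction hz using Submodule.span_induction with
    | mem z hz =>
      induction b using Finsupp.induction_linear with
      | zero => rw [show smashMulS k R act z 0 = 0 from map_zero (LeibAux.lmulH hact z)]
                exact Submodule.zero_mem _
      | add b b' h h' => rw [LeibAux.smash_add_right hact]; exact Submodule.add_mem _ h h'
      | single W s => exact LeibAux.right_gen hact hleib hz W s
    | zero =>
      rw [show smashMulS k R act 0 b = 0 from map_zero (LeibAux.rmulH act b)]
      exact Submodule.zero_mem _
    | add x y _ _ hx hy =>
      rw [LeibAux.smash_add_left]; exact Submodule.add_mem _ hx hy
    | smul a x _ hx =>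
      rw [LeibAux.smash_smul_left]; exact Submodule.smul_mem _ _ hx
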